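/- Suppose the curve of metrics g(t) satisfies Assumption (A), fix t ≥ t₀ with g = g(t), e = e(t), and let ω be a Euclidean unit vector. Define the post-collision momentum (Strain parametrization) p'_i = (p_i+q_i)/2 + (h/2)[ g_{ia}e^a_bω^b + (n⁰/√s − 1)(n_a e^a_b ω^b) n_i/(g^{cd}n_c n_d) ]. Then for all covariant momenta p_*, q_* with p_* ≠ q_* and n_* ≠ 0, and all i,k ∈ {1,2,3}: |∂_{p_k} p'_i| ≤ C (1 + p⁰/|û| + p⁰/|n̂| + (p⁰)²/|û|²) (q⁰)³, where |û| = √(g_{ab}u^a u^b), |n̂| = √(g_{ab}n^a n^b), and C depends only on the constant in Assumption (A) and not on t, the metric, p_*, q_*, or ω. -/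

import Mathlib

open Matrix

/-- The Cholesky factor of a symmetric positive definite `3×3` matrix `g`: the lower
triangular matrix `θ` with positive diagonal such that `g = θ * θᵀ`, given by its
explicit formula in terms of the leading principal minors of `g`. -/
noncomputable def chol (g : Matrix (Fin 3) (Fin 3) ℝ) : Matrix (Fin 3) (Fin 3) ℝ :=
  !![g 0 0 / Real.sqrt (g 0 0), 0, 0;
     g 0 1 / Real.sqrt (g 0 0),
       (g 0 0 * g 1 1 - g 0 1 ^ 2) /
         (Real.sqrt (g 0 0) * Real.sqrt (g 0 0 * g 1 1 - g 0 1 ^ 2)), 0;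
     g 0 2 / Real.sqrt (g 0 0),
       (g 0 0 * g 1 2 - g 0 1 * g 0 2) /
         (Real.sqrt (g 0 0) * Real.sqrt (g 0 0 * g 1 1 - g 0 1 ^ 2)),
       g.det / (Real.sqrt (g 0 0 * g 1 1 - g 0 1 ^ 2) * Real.sqrt g.det)]

/-- The orthonormal frame `e^a_b` obtained from the Cholesky factorization,
satisfying `g_{ab} e^a_c e^b_d = δ_{cd}`; its inverse is `θ^a_b = (chol g)ᵀ`. -/
noncomputable def frameE (g : Matrix (Fin 3) (Fin 3) ℝ) : Matrix (Fin 3) (Fin 3) ℝ :=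
  ((chol g)ᵀ)⁻¹

/-- The energy `p⁰ = √(1 + g^{ab} p_a p_b)`. -/
noncomputable def energy (g : Matrix (Fin 3) (Fin 3) ℝ) (p : Fin 3 → ℝ) : ℝ :=
  Real.sqrt (1 + p ⬝ᵥ (g⁻¹ *ᵥ p))

/-- The relative momentum `h`. -/
noncomputable def relMom (g : Matrix (Fin 3) (Fin 3) ℝ) (p q : Fin 3 → ℝ) : ℝ :=
  Real.sqrt (-(energy g p - energy g q) ^ 2 + (p - q) ⬝ᵥ (g⁻¹ *ᵥ (p - q)))

/-- The total energy `s`. -/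
noncomputable def totEnergy (g : Matrix (Fin 3) (Fin 3) ℝ) (p q : Fin 3 → ℝ) : ℝ :=
  (energy g p + energy g q) ^ 2 - (p + q) ⬝ᵥ (g⁻¹ *ᵥ (p + q))

/-- Assumption (A) on a curve of metrics `g(t)`, `t ≥ t₀ > 0`, with constant `CA` and
parameter `ε₁`: writing `g_{ab}(t) = t^{4/3}ḡ_{ab}(t)` and `g^{ab}(t) = t^{−4/3}ḡ^{ab}(t)`,
all entries satisfy `|ḡ_{ab}| ≤ CA`, `|ḡ^{ab}| ≤ CA`; the Cholesky orthonormal frame and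
its inverse satisfy `|e^a_b| ≤ CA t^{−2/3}`, `|θ^a_b| ≤ CA t^{2/3}`; and for some
`0 < ε₁ < 1/12`, `t ↦ t^{−ε₁} ḡ^{ab}(t) p_a p_b` is non-increasing for every `p`. -/
def AssumpA (t₀ CA ε₁ : ℝ) (g : ℝ → Matrix (Fin 3) (Fin 3) ℝ) : Prop :=
  (∀ t ∈ Set.Ici t₀, (g t).PosDef) ∧
  (∀ t ∈ Set.Ici t₀, ∀ a b : Fin 3,
    |t ^ (-(4 : ℝ) / 3) * g t a b| ≤ CA ∧
    |t ^ ((4 : ℝ) / 3) * (g t)⁻¹ a b| ≤ CA ∧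
    |frameE (g t) a b| ≤ CA * t ^ (-(2 : ℝ) / 3) ∧
    |(chol (g t))ᵀ a b| ≤ CA * t ^ ((2 : ℝ) / 3)) ∧
  (0 < ε₁ ∧ ε₁ < 1 / 12) ∧
  (∀ p : Fin 3 → ℝ,
    AntitoneOn (fun t => t ^ ((4 : ℝ) / 3 - ε₁) * (p ⬝ᵥ ((g t)⁻¹ *ᵥ p))) (Set.Ici t₀))


/-- The Strain post-collision momentum in covariant variables:
`p'_i = (p_i+q_i)/2 + (h/2)[g_{ia}e^a_bω^b + (n⁰/√s − 1)(n_ae^a_bω^b)n_i/(g^{cd}n_cn_d)]`. -/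
noncomputable def pSt (g : Matrix (Fin 3) (Fin 3) ℝ) (ω p q : Fin 3 → ℝ) (i : Fin 3) : ℝ :=
  (p i + q i) / 2 + relMom g p q / 2 *
    ((g *ᵥ (frameE g *ᵥ ω)) i +
      ((energy g p + energy g q) / Real.sqrt (totEnergy g p q) - 1) *
        ((p + q) ⬝ᵥ (frameE g *ᵥ ω)) * (p i + q i) /
        ((p + q) ⬝ᵥ (g⁻¹ *ᵥ (p + q))))

section MassShell

variable {V : Type*} [NormedAddCommGroup V]

/-- The energy `√(1 + ‖x‖²)` of a unit mass with momentum `x`. -/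
noncomputable def shellEnergy (x : V) : ℝ := Real.sqrt (1 + ‖x‖ ^ 2)

lemma shellEnergy_sq (x : V) : shellEnergy x ^ 2 = 1 + ‖x‖ ^ 2 :=
  Real.sq_sqrt (by positivity)

lemma one_le_shellEnergy (x : V) : 1 ≤ shellEnergy x := by
  rw [shellEnergy, Real.one_le_sqrt]
  nlinarith [sq_nonneg ‖x‖]

lemma norm_le_shellEnergy (x : V) : ‖x‖ ≤ shellEnergy x :=
  Real.le_sqrt_of_sq_le (by linarith)

variable [InnerProductSpace ℝ V]

/-- The Minkowski product of two points of the unit mass shell. -/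
noncomputable def shellProd (p q : V) : ℝ := shellEnergy p * shellEnergy q - inner ℝ p q

lemma one_le_shellProd (p q : V) : 1 ≤ shellProd p q := by
  have hp1 := one_le_shellEnergy p
  have hq1 := one_le_shellEnergy q
  have hu := norm_sub_sq_real p q
  have hcs := abs_le.mp (abs_real_inner_le_norm p q)
  have hsq : (inner ℝ p q) ^ 2 ≤ (‖p‖ * ‖q‖) ^ 2 := sq_le_sq' hcs.1 hcs.2
  have : 1 + inner ℝ p q ≤ shellEnergy p * shellEnergy q := by
    refine le_of_sq_le_sq ?_ (by positivity)
    rw [mul_pow, shellEnergy_sq, shellEnergy_sq]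
    nlinarith [sq_nonneg ‖p - q‖]
  unfold shellProd
  linarith

lemma norm_sub_sq_eq (p q : V) :
    ‖p - q‖ ^ 2 = (shellEnergy p - shellEnergy q) ^ 2 + 2 * (shellProd p q - 1) := by
  rw [norm_sub_sq_real, shellProd]
  nlinarith [shellEnergy_sq p, shellEnergy_sq q]

lemma norm_sub_sq_le (p q : V) :
    ‖p - q‖ ^ 2 ≤ 2 * (shellProd p q - 1) * (shellEnergy p * shellEnergy q) := by
  have hp := shellEnergy_sq p
  have hq := shellEnergy_sq q
  have hu := norm_sub_sq_real p q
  have hcs := abs_le.mp (abs_real_inner_le_norm p q)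
  have hsq : (inner ℝ p q) ^ 2 ≤ (‖p‖ * ‖q‖) ^ 2 := sq_le_sq' hcs.1 hcs.2
  have hm := one_le_shellProd p q
  have hprod : (shellEnergy p * shellEnergy q) ^ 2 = (1 + ‖p‖ ^ 2) * (1 + ‖q‖ ^ 2) := by
    rw [mul_pow, hp, hq]
  unfold shellProd at *
  generalize shellEnergy p * shellEnergy q = e at *
  nlinarith [sq_nonneg (e - inner ℝ p q - 1)]

lemma shellEnergy_le (p q : V) : shellEnergy p ≤ 2 * shellProd p q * shellEnergy q := by
  have hq := shellEnergy_sq q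
  have hp1 := one_le_shellEnergy p
  have hpn := norm_le_shellEnergy p
  have hqn := norm_le_shellEnergy q
  have hm := one_le_shellProd p q
  have hcs := real_inner_le_norm p q
  have h1 : shellEnergy p * (shellEnergy q - ‖q‖) ≤ shellProd p q := by
    unfold shellProd
    nlinarith [mul_le_mul_of_nonneg_right hpn (norm_nonneg q)]
  have h2 := mul_le_mul_of_nonneg_right h1 (add_nonneg ((norm_nonneg q).trans hqn) (norm_nonneg q))
  nlinarith

lemma abs_inner_sub_inner_le (p q v : V) :
    |inner ℝ p v / shellEnergy p * shellEnergy q - inner ℝ q v| * shellEnergy p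
      ≤ 2 * shellEnergy q * ‖p - q‖ * ‖v‖ := by
  have hp1 := one_le_shellEnergy p
  have hq1 := one_le_shellEnergy q
  have hqn := norm_le_shellEnergy q
  have hE : |shellEnergy q - shellEnergy p| ≤ ‖p - q‖ := by
    refine abs_le_of_sq_le_sq ?_ (norm_nonneg _)
    nlinarith [norm_sub_sq_eq p q, one_le_shellProd p q]
  have hp0 : shellEnergy p ≠ 0 := by positivity
  have key : (inner ℝ p v / shellEnergy p * shellEnergy q - inner ℝ q v) * shellEnergy p
      = inner ℝ (shellEnergy q • (p - q) + (shellEnergy q - shellEnergy p) • q) v := by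
    simp only [inner_add_left, real_inner_smul_left, inner_sub_left]
    field_simp
    ring
  rw [← abs_of_nonneg (zero_le_one.trans hp1), ← abs_mul, abs_of_nonneg (zero_le_one.trans hp1),
    key]
  refine (abs_real_inner_le_norm _ _).trans ?_
  refine mul_le_mul_of_nonneg_right ?_ (norm_nonneg v)
  refine (norm_add_le _ _).trans ?_
  rw [norm_smul, norm_smul, Real.norm_eq_abs, Real.norm_eq_abs,
    abs_of_nonneg (zero_le_one.trans hq1)]
  nlinarith [mul_le_mul hE hqn (norm_nonneg _) (norm_nonneg _)]

lemma hasDerivAt_line (p v : V) : HasDerivAt (fun x : ℝ => p + x • v) v 0 := by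
  simpa using ((hasDerivAt_id (0 : ℝ)).smul_const v).const_add p

lemma hasDerivAt_inner_line (p v w : V) :
    HasDerivAt (fun x : ℝ => inner ℝ (p + x • v) w) (inner ℝ v w) 0 := by
  simpa using (hasDerivAt_line p v).inner ℝ (hasDerivAt_const (0 : ℝ) w)

lemma hasDerivAt_shellEnergy_line (p v : V) :
    HasDerivAt (fun x : ℝ => shellEnergy (p + x • v)) (inner ℝ p v / shellEnergy p) 0 := by
  have h := (((hasDerivAt_line p v).norm_sq).const_add 1).sqrt (by positivity)
  rwa [zero_smul, add_zero, ← shellEnergy, mul_div_mul_left _ _ two_ne_zero] at h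

lemma hasDerivAt_shellProd_line (p q v : V) :
    HasDerivAt (fun x : ℝ => shellProd (p + x • v) q)
      (inner ℝ p v / shellEnergy p * shellEnergy q - inner ℝ q v) 0 := by
  have h := ((hasDerivAt_shellEnergy_line p v).mul_const (shellEnergy q)).sub
    (hasDerivAt_inner_line p v q)
  rwa [real_inner_comm q v] at h

/-- The component along `w` of the Strain post-collision momentum. -/
noncomputable def strain (ω w q p : V) : ℝ :=
  inner ℝ (p + q) w / 2 + Real.sqrt (2 * shellProd p q - 2) / 2 *
    (inner ℝ ω w + inner ℝ (p + q) ω * inner ℝ (p + q) w /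
      (Real.sqrt (2 * shellProd p q + 2) *
        (shellEnergy p + shellEnergy q + Real.sqrt (2 * shellProd p q + 2))))

lemma abs_strain_deriv_formula_le {v W N d h S A a b a' b' c e w' Q : ℝ} (hv : 0 ≤ v) (hW : 0 ≤ W)
    (hh : 0 ≤ h) (hS : 0 < S) (hA : 0 < A) (hQ : 1 ≤ Q) (hNA : N ≤ A) (hhS : h ≤ S)
    (ha : |a| ≤ N) (hb : |b| ≤ N * W) (ha' : |a'| ≤ v) (hb' : |b'| ≤ v * W) (hc : |c| ≤ W)
    (he : |e| ≤ v) (hw' : |w'| ≤ v * W) (hd : |d| ≤ 2 * Q * v) (hdN : |d| * N ≤ 4 * Q * v * S) :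
    |w' / 2 + (d / 2 * (c + a * b / (S * A)) + h / 2 *
      (((a' * b + a * b') * (S * A) - a * b * (h * d / S * A + S * (e + h * d / S)))
        / (S * A) ^ 2))| ≤ 8 * Q * (v * W) := by
  have hx : |a / A| ≤ 1 := by
    rw [abs_div, abs_of_pos hA, div_le_one hA]; linarith
  have hy : |b / A| ≤ W := by
    rw [abs_div, abs_of_pos hA, div_le_iff₀ hA]; nlinarith
  have hr : |h / S| ≤ 1 := by
    rw [abs_div, abs_of_pos hS, abs_of_nonneg hh, div_le_one hS]; exact hhS
  have hz : |d * b / S| ≤ 4 * Q * v * W := by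
    rw [abs_div, abs_mul, abs_of_pos hS, div_le_iff₀ hS]
    calc |d| * |b| ≤ |d| * (N * W) := by gcongr
      _ = |d| * N * W := by ring
      _ ≤ 4 * Q * v * S * W := by gcongr
      _ = _ := by ring
  have heq : w' / 2 + (d / 2 * (c + a * b / (S * A)) + h / 2 *
      (((a' * b + a * b') * (S * A) - a * b * (h * d / S * A + S * (e + h * d / S)))
        / (S * A) ^ 2)) =
      w' / 2 + d * c / 2 + (a / A) * (d * b / S) / 2 + (h / S) * (a' * (b / A)) / 2
      + (h / S) * ((a / A) * b') / 2 - (h / S) * (h / S) * ((a / A) * (d * b / S)) / 2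
      - (h / S) * ((a / A) * ((b / A) * e)) / 2
      - (h / S) * ((h / S) * ((a / A) * ((b / A) * d))) / 2 := by
    field_simp
    ring
  rw [heq]
  generalize a / A = X at *
  generalize b / A = Y at *
  generalize h / S = R at *
  generalize d * b / S = Z at *
  have t1 : |d * c| ≤ 2 * Q * v * W := by rw [abs_mul]; gcongr
  have t2 : |X * Z| ≤ 4 * Q * v * W := by
    rw [abs_mul]; simpa using mul_le_mul hx hz (abs_nonneg _) zero_le_one
  have hR {m M : ℝ} (hm : |m| ≤ M) : |R * m| ≤ M := by
    rw [abs_mul]; simpa using mul_le_mul hr hm (abs_nonneg _) zero_le_one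
  have hX {m M : ℝ} (hm : |m| ≤ M) : |X * m| ≤ M := by
    rw [abs_mul]; simpa using mul_le_mul hx hm (abs_nonneg _) zero_le_one
  have hY {m M : ℝ} (hm : |m| ≤ M) : |Y * m| ≤ W * M := by
    rw [abs_mul]; exact mul_le_mul hy hm (abs_nonneg _) hW
  have t3 : |R * (a' * Y)| ≤ W * v := hR (by rw [mul_comm]; exact hY ha')
  have t4 : |R * (X * b')| ≤ v * W := hR (hX hb')
  have t5 : |R * R * (X * Z)| ≤ 4 * Q * v * W := by rw [mul_assoc]; exact hR (hR t2)
  have t6 : |R * (X * (Y * e))| ≤ W * v := hR (hX (hY he))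
  have t7 : |R * (R * (X * (Y * d)))| ≤ W * (2 * Q * v) := hR (hR (hX (hY hd)))
  have hvW : 0 ≤ v * W := mul_nonneg hv hW
  have hQ' : v * W ≤ Q * (v * W) := le_mul_of_one_le_left hvW hQ
  rw [abs_le] at *
  constructor <;> nlinarith

lemma abs_deriv_strain_le (ω w q p v : V) (hω : ‖ω‖ = 1) (hpq : p ≠ q) :
    |deriv (fun x : ℝ => strain ω w q (p + x • v)) 0|
      ≤ 8 * shellEnergy q ^ 3 * (‖v‖ * ‖w‖) := by
  have hp1 := one_le_shellEnergy p
  have hq1 := one_le_shellEnergy q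
  have hm1 := one_le_shellProd p q
  have hu : 0 < ‖p - q‖ := norm_pos_iff.mpr (sub_ne_zero.mpr hpq)
  have hle := norm_sub_sq_le p q
  have hm : 0 < 2 * shellProd p q - 2 := by
    have h1 : 0 < 2 * (shellProd p q - 1) * (shellEnergy p * shellEnergy q) :=
      (pow_pos hu 2).trans_le hle
    have := pos_of_mul_pos_left h1 (by positivity)
    linarith
  have hs : 0 < 2 * shellProd p q + 2 := by linarith
  set m' := inner ℝ p v / shellEnergy p * shellEnergy q - inner ℝ q v with hm'
  have hS0 := Real.sqrt_pos.mpr hs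
  have hh0 := Real.sqrt_pos.mpr hm
  have hSsq := Real.sq_sqrt hs.le
  have hhsq := Real.sq_sqrt hm.le
  have dm := hasDerivAt_shellProd_line p q v
  have dh := ((dm.const_mul 2).sub_const 2).sqrt (by simpa using hm.ne')
  have dS := ((dm.const_mul 2).add_const 2).sqrt (by simpa using hs.ne')
  have dA := ((hasDerivAt_shellEnergy_line p v).add_const (shellEnergy q)).add dS
  have da := hasDerivAt_inner_line (p + q) v ω
  have db := hasDerivAt_inner_line (p + q) v w
  have hA0 : 0 < shellEnergy p + shellEnergy q + Real.sqrt (2 * shellProd p q + 2) := by positivity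
  have dF := (db.div_const 2).add ((dh.div_const 2).mul
    (((da.mul db).div (dS.mul dA) (by simpa using ⟨hS0.ne', hA0.ne'⟩)).const_add (inner ℝ ω w)))
  have dG := dF.congr_of_eventuallyEq (f₁ := fun x : ℝ => strain ω w q (p + x • v))
    (.of_forall fun x => by simp only [strain, add_right_comm p (x • v) q]; rfl)
  rw [dG.deriv]
  simp only [Pi.mul_apply, Pi.add_apply, Pi.div_apply, zero_smul, add_zero, ← hm']
  have key := abs_inner_sub_inner_le p q v
  rw [← hm'] at key
  set h := Real.sqrt (2 * shellProd p q - 2) with hh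
  set S := Real.sqrt (2 * shellProd p q + 2) with hS
  set P := shellEnergy p with hP
  set Q := shellEnergy q with hQ
  have hD : (m' / h) ^ 2 * P ≤ 4 * Q ^ 3 * ‖v‖ ^ 2 := by
    have h1 : (|m'| * P) ^ 2 ≤ (2 * Q * ‖p - q‖ * ‖v‖) ^ 2 := by gcongr
    have h2 : (2 * Q * ‖p - q‖ * ‖v‖) ^ 2 ≤ 4 * Q ^ 2 * ‖v‖ ^ 2 * (h ^ 2 * (P * Q)) := by
      have : ‖p - q‖ ^ 2 ≤ h ^ 2 * (P * Q) := by rw [hhsq]; linarith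
      calc _ = 4 * Q ^ 2 * ‖v‖ ^ 2 * ‖p - q‖ ^ 2 := by ring
        _ ≤ _ := by gcongr
    have h3 := h1.trans h2
    rw [mul_pow, sq_abs] at h3
    rw [div_pow, div_mul_eq_mul_div, div_le_iff₀ (by positivity)]
    refine le_of_mul_le_mul_right ?_ (zero_lt_one.trans_le hp1)
    nlinarith
  have hPs : P ≤ Q * S ^ 2 := by
    rw [hSsq]; nlinarith [shellEnergy_le p q]
  have hd : |m' / h| ≤ 2 * Q ^ 3 * ‖v‖ := by
    refine abs_le_of_sq_le_sq ?_ (by positivity)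
    have h1 : (m' / h) ^ 2 ≤ (m' / h) ^ 2 * P := le_mul_of_one_le_right (sq_nonneg _) hp1
    have h2 : Q ^ 3 ≤ Q ^ 6 := pow_le_pow_right₀ hq1 (by norm_num)
    have h3 := mul_le_mul_of_nonneg_right h2 (sq_nonneg ‖v‖)
    nlinarith
  have hdN : |m' / h| * (P + Q) ≤ 4 * Q ^ 3 * ‖v‖ * S := by
    refine le_of_sq_le_sq ?_ (by positivity)
    have h1 : P + Q ≤ 2 * (P * Q) := by nlinarith
    calc (|m' / h| * (P + Q)) ^ 2 ≤ (|m' / h| * (2 * (P * Q))) ^ 2 := by gcongr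
      _ = (m' / h) ^ 2 * P * (4 * (P * Q ^ 2)) := by rw [mul_pow, sq_abs]; ring
      _ ≤ 4 * Q ^ 3 * ‖v‖ ^ 2 * (4 * (Q * S ^ 2 * Q ^ 2)) := by gcongr
      _ = _ := by ring
  have hnN : ‖p + q‖ ≤ P + Q :=
    (norm_add_le p q).trans (add_le_add (norm_le_shellEnergy p) (norm_le_shellEnergy q))
  have hhS : h ≤ S := Real.sqrt_le_sqrt (by linarith)
  have bound := abs_strain_deriv_formula_le (v := ‖v‖)
    (W := ‖w‖) (N := P + Q) (d := m' / h) (h := h) (S := S)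
    (A := P + Q + S) (a := inner ℝ (p + q) ω) (b := inner ℝ (p + q) w) (a' := inner ℝ v ω)
    (b' := inner ℝ v w) (c := inner ℝ ω w) (e := inner ℝ p v / P) (w' := inner ℝ v w)
    (Q := Q ^ 3) (norm_nonneg _) (norm_nonneg _) hh0.le hS0 hA0
    (one_le_pow₀ hq1) (by linarith) hhS
    ((abs_real_inner_le_norm _ _).trans (by rw [hω, mul_one]; exact hnN))
    ((abs_real_inner_le_norm _ _).trans (by gcongr))
    ((abs_real_inner_le_norm _ _).trans (by rw [hω, mul_one]))
    (abs_real_inner_le_norm _ _)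
    ((abs_real_inner_le_norm _ _).trans (by rw [hω, one_mul]))
    (by
      rw [abs_div, abs_of_pos (zero_lt_one.trans_le hp1), div_le_iff₀ (zero_lt_one.trans_le hp1)]
      refine (abs_real_inner_le_norm _ _).trans ?_
      rw [mul_comm]
      exact mul_le_mul_of_nonneg_left (norm_le_shellEnergy p) (norm_nonneg v))
    (abs_real_inner_le_norm _ _) hd hdN
  convert bound using 2
  have e1 : 2 * m' / (2 * h) = m' / h := by field_simp
  have e2 : 2 * m' / (2 * S) = h * (m' / h) / S := by field_simp
  rw [e2, ← e1]

end MassShell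

section Cholesky

variable {g : Matrix (Fin 3) (Fin 3) ℝ}

lemma chol_mul_transpose (hg : g.PosDef) : chol g * (chol g)ᵀ = g := by
  have s10 : g 1 0 = g 0 1 := by simpa using hg.isHermitian.apply 0 1
  have s20 : g 2 0 = g 0 2 := by simpa using hg.isHermitian.apply 0 2
  have s21 : g 2 1 = g 1 2 := by simpa using hg.isHermitian.apply 1 2
  have h0 : 0 < g 0 0 := hg.diag_pos
  have h1 : 0 < g 0 0 * g 1 1 - g 0 1 ^ 2 := by
    have := (hg.submatrix (e := ![0, 1]) (by decide)).det_pos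
    rw [Matrix.det_fin_two] at this
    simpa [s10, sq] using this
  have h2 : 0 < g.det := hg.det_pos
  have hd : g.det = g 0 0 * g 1 1 * g 2 2 - g 0 0 * g 1 2 ^ 2 - g 0 1 ^ 2 * g 2 2
      + 2 * (g 0 1 * g 1 2 * g 0 2) - g 0 2 ^ 2 * g 1 1 := by
    rw [Matrix.det_fin_three, s10, s20, s21]; ring
  have e0 := Real.sq_sqrt h0.le
  have e1 := Real.sq_sqrt h1.le
  have e2 := Real.sq_sqrt h2.le
  have p0 := Real.sqrt_pos.mpr h0
  have p1 := Real.sqrt_pos.mpr h1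
  have p2 := Real.sqrt_pos.mpr h2
  ext i j
  fin_cases i <;> fin_cases j <;>
    simp [chol, Matrix.mul_apply, Fin.sum_univ_three, s10, s20, s21] <;>
    field_simp <;> simp only [e0, e1, e2] <;> field_simp <;> (try rw [hd]) <;> ring

lemma isUnit_det_chol (hg : g.PosDef) : IsUnit (chol g).det := by
  have h := congrArg Matrix.det (chol_mul_transpose hg)
  rw [Matrix.det_mul] at h
  exact isUnit_of_mul_isUnit_left (h ▸ hg.det_pos.ne'.isUnit)

/-- The components of a covariant momentum in the orthonormal frame. -/
noncomputable def frameCoord (g : Matrix (Fin 3) (Fin 3) ℝ) :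
    (Fin 3 → ℝ) →ₗ[ℝ] EuclideanSpace ℝ (Fin 3) :=
  (WithLp.linearEquiv 2 ℝ (Fin 3 → ℝ)).symm.toLinearMap ∘ₗ (frameE g)ᵀ.mulVecLin

lemma frameCoord_apply (p : Fin 3 → ℝ) :
    frameCoord g p = WithLp.toLp 2 ((frameE g)ᵀ *ᵥ p) := rfl

lemma inner_toLp (x y : Fin 3 → ℝ) : inner ℝ (WithLp.toLp 2 x) (WithLp.toLp 2 y) = x ⬝ᵥ y := by
  rw [EuclideanSpace.inner_toLp_toLp, star_trivial, dotProduct_comm]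

lemma inner_frameCoord (hg : g.PosDef) (p q : Fin 3 → ℝ) :
    inner ℝ (frameCoord g p) (frameCoord g q) = p ⬝ᵥ (g⁻¹ *ᵥ q) := by
  have h : frameE g * (frameE g)ᵀ = g⁻¹ := by
    conv_rhs => rw [← chol_mul_transpose hg, Matrix.mul_inv_rev]
    rw [frameE, Matrix.transpose_nonsing_inv, Matrix.transpose_transpose]
  rw [frameCoord_apply, frameCoord_apply, inner_toLp, ← h, ← Matrix.mulVec_mulVec,
    Matrix.mulVec_transpose, ← Matrix.dotProduct_mulVec]

lemma norm_frameCoord_sq (hg : g.PosDef) (p : Fin 3 → ℝ) :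
    ‖frameCoord g p‖ ^ 2 = p ⬝ᵥ (g⁻¹ *ᵥ p) := by
  rw [← real_inner_self_eq_norm_sq, inner_frameCoord hg]

lemma frameCoord_injective (hg : g.PosDef) : Function.Injective (frameCoord g) := by
  rw [injective_iff_map_eq_zero]
  intro p hp
  by_contra hne
  have := hg.inv.dotProduct_mulVec_pos hne
  rw [star_trivial, ← norm_frameCoord_sq hg, hp] at this
  simp at this

lemma inner_frameCoord_chol (hg : g.PosDef) (p : Fin 3 → ℝ) (i : Fin 3) :
    inner ℝ (frameCoord g p) (WithLp.toLp 2 ((chol g).row i)) = p i := by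
  have h : chol g * (frameE g)ᵀ = 1 := by
    rw [frameE, Matrix.transpose_nonsing_inv, Matrix.transpose_transpose,
      Matrix.mul_nonsing_inv _ (isUnit_det_chol hg)]
  calc inner ℝ (frameCoord g p) (WithLp.toLp 2 ((chol g).row i))
      = (chol g *ᵥ ((frameE g)ᵀ *ᵥ p)) i := by
        rw [frameCoord_apply, inner_toLp, dotProduct_comm]; rfl
    _ = p i := by rw [Matrix.mulVec_mulVec, h, Matrix.one_mulVec]

lemma inner_chol (hg : g.PosDef) (ω : Fin 3 → ℝ) (i : Fin 3) :
    inner ℝ (WithLp.toLp 2 ω) (WithLp.toLp 2 ((chol g).row i)) = (g *ᵥ (frameE g *ᵥ ω)) i := by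
  have h : g * frameE g = chol g := by
    have hu : IsUnit (chol g)ᵀ.det := by rw [Matrix.det_transpose]; exact isUnit_det_chol hg
    nth_rw 1 [← chol_mul_transpose hg]
    rw [frameE, Matrix.mul_assoc, Matrix.mul_nonsing_inv _ hu, Matrix.mul_one]
  rw [Matrix.mulVec_mulVec, h, inner_toLp, dotProduct_comm]
  rfl

lemma inner_frameCoord_toLp (p ω : Fin 3 → ℝ) :
    inner ℝ (frameCoord g p) (WithLp.toLp 2 ω) = p ⬝ᵥ (frameE g *ᵥ ω) := by
  rw [frameCoord_apply, inner_toLp, Matrix.mulVec_transpose, ← Matrix.dotProduct_mulVec]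

lemma norm_chol_row_sq (hg : g.PosDef) (i : Fin 3) :
    ‖(WithLp.toLp 2 ((chol g).row i) : EuclideanSpace ℝ (Fin 3))‖ ^ 2 = g i i := by
  rw [← real_inner_self_eq_norm_sq, inner_toLp]
  conv_rhs => rw [← chol_mul_transpose hg]
  rfl

lemma shellEnergy_frameCoord (hg : g.PosDef) (p : Fin 3 → ℝ) :
    shellEnergy (frameCoord g p) = energy g p := by
  rw [shellEnergy, energy, norm_frameCoord_sq hg]

lemma totEnergy_eq (hg : g.PosDef) (p q : Fin 3 → ℝ) :
    totEnergy g p q = 2 * shellProd (frameCoord g p) (frameCoord g q) + 2 := by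
  rw [totEnergy, ← norm_frameCoord_sq hg, map_add, norm_add_sq_real, shellProd,
    ← shellEnergy_frameCoord hg, ← shellEnergy_frameCoord hg]
  linear_combination shellEnergy_sq (frameCoord g p) + shellEnergy_sq (frameCoord g q)

lemma relMom_eq (hg : g.PosDef) (p q : Fin 3 → ℝ) :
    relMom g p q = Real.sqrt (2 * shellProd (frameCoord g p) (frameCoord g q) - 2) := by
  rw [relMom, ← norm_frameCoord_sq hg, map_sub, norm_sub_sq_eq, shellEnergy_frameCoord hg,
    shellEnergy_frameCoord hg]
  congr 1
  ring

lemma pSt_eq_strain (hg : g.PosDef) (ω p q : Fin 3 → ℝ) (i : Fin 3) :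
    pSt g ω p q i = strain (WithLp.toLp 2 ω) (WithLp.toLp 2 ((chol g).row i)) (frameCoord g q)
      (frameCoord g p) := by
  have hs : 0 < totEnergy g p q := by
    rw [totEnergy_eq hg]
    linarith [one_le_shellProd (frameCoord g p) (frameCoord g q)]
  have hS := Real.sqrt_pos.mpr hs
  have hsN : Real.sqrt (totEnergy g p q) ^ 2
      = (energy g p + energy g q) ^ 2 - (p + q) ⬝ᵥ (g⁻¹ *ᵥ (p + q)) := Real.sq_sqrt hs.le
  have hn : 0 < energy g p + energy g q := by
    rw [← shellEnergy_frameCoord hg, ← shellEnergy_frameCoord hg]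
    linarith [one_le_shellEnergy (frameCoord g p), one_le_shellEnergy (frameCoord g q)]
  rw [strain, ← map_add, inner_frameCoord_chol hg, inner_chol hg, inner_frameCoord_toLp,
    shellEnergy_frameCoord hg, shellEnergy_frameCoord hg, ← relMom_eq hg, ← totEnergy_eq hg, pSt,
    Pi.add_apply]
  congr 3
  by_cases h0 : p + q = 0
  · simp [h0]
  have hN : 0 < (p + q) ⬝ᵥ (g⁻¹ *ᵥ (p + q)) := by
    simpa using hg.inv.dotProduct_mulVec_pos h0
  generalize (p + q) ⬝ᵥ (g⁻¹ *ᵥ (p + q)) = N at *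
  generalize Real.sqrt (totEnergy g p q) = S at *
  generalize energy g p + energy g q = n at *
  generalize (p + q) ⬝ᵥ (frameE g *ᵥ ω) = a
  have hN' : N = (n - S) * (n + S) := by linear_combination hsN
  have hnS : n + S ≠ 0 := by positivity
  have hdiff : n - S ≠ 0 := fun h => hN.ne' (by rw [hN', h, zero_mul])
  rw [hN']
  field_simp

lemma abs_deriv_pSt_le (hg : g.PosDef) (ω p q : Fin 3 → ℝ) (hω : ω ⬝ᵥ ω = 1) (hpq : p ≠ q)
    (i k : Fin 3) :
    |deriv (fun x => pSt g ω (Function.update p k x) q i) (p k)|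
      ≤ 8 * energy g q ^ 3 * Real.sqrt (g⁻¹ k k * g i i) := by
  have hfun : (fun x => pSt g ω (Function.update p k x) q i) = fun x =>
      (fun y : ℝ => strain (WithLp.toLp 2 ω) (WithLp.toLp 2 ((chol g).row i)) (frameCoord g q)
        (frameCoord g p + y • frameCoord g (Pi.single k 1))) (x - p k) := by
    funext x
    have : Function.update p k x = p + (x - p k) • Pi.single k 1 := by
      ext j
      rcases eq_or_ne j k with rfl | h <;> simp [*]
    rw [pSt_eq_strain hg, this, map_add, map_smul]
  have hnω : ‖(WithLp.toLp 2 ω : EuclideanSpace ℝ (Fin 3))‖ = 1 := by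
    rw [← sq_eq_sq₀ (norm_nonneg _) zero_le_one, ← real_inner_self_eq_norm_sq, inner_toLp, hω,
      one_pow]
  have hnorm : Real.sqrt (g⁻¹ k k * g i i) = ‖frameCoord g (Pi.single k 1)‖ *
      ‖(WithLp.toLp 2 ((chol g).row i) : EuclideanSpace ℝ (Fin 3))‖ := by
    rw [← norm_chol_row_sq hg i, ← Real.sqrt_sq (mul_nonneg (norm_nonneg _) (norm_nonneg _)),
      mul_pow, norm_frameCoord_sq hg]
    simp
  rw [hfun, deriv_comp_sub_const (f := fun y : ℝ => strain _ _ _ (_ + y • _)), sub_self, hnorm,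
    ← shellEnergy_frameCoord hg]
  exact abs_deriv_strain_le _ _ _ _ _ hnω ((frameCoord_injective hg).ne hpq)

end Cholesky

/-- Under Assumption (A), the Strain post-collision momentum satisfies
`|∂_{p_k} p'_i| ≤ C (1 + p⁰/|û| + p⁰/|n̂| + (p⁰)²/|û|²)(q⁰)³` where
`|û| = √(g_{ab}u^au^b)` and `|n̂| = √(g_{ab}n^an^b)`, with `C` depending only on the
constant in Assumption (A), and not on `t`, the metric, the momenta, or `ω`. -/
theorem stmt_14 (t₀ CA ε₁ : ℝ) (ht₀ : 0 < t₀) (hCA : 0 < CA) :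
    ∃ C > 0, ∀ g : ℝ → Matrix (Fin 3) (Fin 3) ℝ, AssumpA t₀ CA ε₁ g →
      ∀ t ∈ Set.Ici t₀, ∀ p q : Fin 3 → ℝ, p ≠ q → p + q ≠ 0 →
      ∀ ω : Fin 3 → ℝ, ω ⬝ᵥ ω = 1 → ∀ i k : Fin 3,
      |deriv (fun x => pSt (g t) ω (Function.update p k x) q i) (p k)|
        ≤ C * (1 + energy (g t) p / Real.sqrt ((p - q) ⬝ᵥ ((g t)⁻¹ *ᵥ (p - q)))
              + energy (g t) p / Real.sqrt ((p + q) ⬝ᵥ ((g t)⁻¹ *ᵥ (p + q)))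
              + (energy (g t) p) ^ 2 / ((p - q) ⬝ᵥ ((g t)⁻¹ *ᵥ (p - q)))) *
            (energy (g t) q) ^ 3 := by
  refine ⟨8 * CA, by positivity, fun g hA t ht p q hpq _ ω hω i k => ?_⟩
  have hg := hA.1 t ht
  have htpos : 0 < t := ht₀.trans_le ht
  have hcancel : t ^ ((4 : ℝ) / 3) * t ^ (-(4 : ℝ) / 3) = 1 := by
    rw [← Real.rpow_add htpos]; norm_num
  have hentries : Real.sqrt ((g t)⁻¹ k k * g t i i) ≤ CA := by
    refine Real.sqrt_le_iff.mpr ⟨hCA.le, ?_⟩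
    calc (g t)⁻¹ k k * g t i i
        = (t ^ ((4 : ℝ) / 3) * (g t)⁻¹ k k) * (t ^ (-(4 : ℝ) / 3) * g t i i) := by
          linear_combination -((g t)⁻¹ k k * g t i i) * hcancel
      _ ≤ |t ^ ((4 : ℝ) / 3) * (g t)⁻¹ k k| * |t ^ (-(4 : ℝ) / 3) * g t i i| := by
          rw [← abs_mul]; exact le_abs_self _
      _ ≤ CA * CA :=
          mul_le_mul (hA.2.1 t ht k k).2.1 (hA.2.1 t ht i i).1 (abs_nonneg _) hCA.le
      _ = CA ^ 2 := by ring
  have hp0 : 0 ≤ energy (g t) p := Real.sqrt_nonneg _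
  have hq0 : 0 ≤ energy (g t) q := Real.sqrt_nonneg _
  have hu : 0 ≤ (p - q) ⬝ᵥ ((g t)⁻¹ *ᵥ (p - q)) := by
    rw [← norm_frameCoord_sq hg]; positivity
  have hfactor : 1 ≤ 1 + energy (g t) p / Real.sqrt ((p - q) ⬝ᵥ ((g t)⁻¹ *ᵥ (p - q)))
      + energy (g t) p / Real.sqrt ((p + q) ⬝ᵥ ((g t)⁻¹ *ᵥ (p + q)))
      + (energy (g t) p) ^ 2 / ((p - q) ⬝ᵥ ((g t)⁻¹ *ᵥ (p - q))) := by
    rw [add_assoc, add_assoc]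
    exact le_add_of_nonneg_right (by positivity)
  calc _ ≤ 8 * energy (g t) q ^ 3 * Real.sqrt ((g t)⁻¹ k k * g t i i) :=
        abs_deriv_pSt_le hg ω p q hω hpq i k
    _ ≤ 8 * energy (g t) q ^ 3 * CA := by gcongr
    _ = 8 * CA * 1 * energy (g t) q ^ 3 := by ring
    _ ≤ _ := by gcongr
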